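/- arXiv:2205.12246 — 2 statements merged into one kernel-verified Lean document; each statement's English description precedes it below -/
import Mathlib

section
/- Let G be a simple graph on n vertices. For each edge e of G, let p(e) denote the largest integer k such that e is an edge of a subgraph of G isomorphic to the path P_k with k edges. Then the sum over all edges e of G of 1/p(e) is at most n/2. -/
namespace LocEG

set_option linter.unusedSectionVars false

variable {V : Type*} [Fintype V] [DecidableEq V]

/-- `l` lists the vertices of a path of `G` inside `A`. -/
def PathIn (G : SimpleGraph V) (A : Finset V) (l : List V) : Prop :=
  l.Nodup ∧ l.IsChain G.Adj ∧ ∀ x ∈ l, x ∈ A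

/-- `l` is a longest path inside `A`, with `k` edges. -/
def MaxPath (G : SimpleGraph V) (A : Finset V) (k : ℕ) (l : List V) : Prop :=
  PathIn G A l ∧ l.length = k + 1 ∧ ∀ l', PathIn G A l' → l'.length ≤ k + 1

lemma chain_reverse (G : SimpleGraph V) {l : List V} (h : l.IsChain G.Adj) :
    l.reverse.IsChain G.Adj := by
  rw [List.isChain_reverse]
  exact h.imp (fun _ _ h => h.symm)

lemma MaxPath.of_perm {G : SimpleGraph V} {A : Finset V} {k : ℕ} {l l' : List V}
    (h : MaxPath G A k l) (hp : l'.Perm l) (hc : l'.IsChain G.Adj) : MaxPath G A k l' :=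
  ⟨⟨hp.nodup_iff.2 h.1.1, hc, fun x hx => h.1.2.2 x (hp.mem_iff.1 hx)⟩,
    hp.length_eq.trans h.2.1, h.2.2⟩

lemma exists_maxPath (G : SimpleGraph V) (A : Finset V) (hA : A.Nonempty) :
    ∃ k l, MaxPath G A k l := by
  classical
  obtain ⟨x, hx⟩ := hA
  let P : ℕ → Prop := fun k => ∃ l, PathIn G A l ∧ l.length = k + 1
  have h0 : P 0 := ⟨[x], ⟨by simp, by simp, by simpa using hx⟩, rfl⟩
  have hb : ∀ k, P k → k ≤ Fintype.card V := by
    rintro k ⟨l, hl, hk⟩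
    have := hl.1.length_le_card
    omega
  have hs := Nat.findGreatest_spec (P := P) (Nat.zero_le (Fintype.card V)) h0
  obtain ⟨l, hl, hk⟩ := hs
  refine ⟨_, l, hl, hk, fun l' hl' => ?_⟩
  by_contra hcon
  have hP : P (l'.length - 1) := ⟨l', hl', by omega⟩
  have := Nat.le_findGreatest (P := P) (hb _ hP) hP
  omega

/-- Neighbours of the head of a longest path. -/
lemma head_nbr {G : SimpleGraph V} {A : Finset V} {k : ℕ} {v a : V} {r : List V} {p : Sym2 V → ℕ}
    (hq : ∀ s a b t, (s ++ a :: b :: t).Nodup → (s ++ a :: b :: t).IsChain G.Adj →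
      s.length + t.length + 1 ≤ p s(a, b))
    (h : MaxPath G A k (v :: r)) (ha : a ∈ A) (hva : G.Adj v a) :
    a ∈ r ∧ k ≤ p s(v, a) := by
  have har : a ∈ r := by
    by_contra hn
    have := h.2.2 (a :: v :: r) ⟨by
      refine List.nodup_cons.2 ⟨?_, h.1.1⟩
      simp [hn, hva.ne'], by
      rw [List.isChain_cons_cons]
      exact ⟨hva.symm, h.1.2.1⟩, by
      intro x hx
      rcases List.mem_cons.1 hx with rfl | hx
      · exact ha
      · exact h.1.2.2 x hx⟩
    have h2 := h.2.1
    simp at this h2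
    omega
  refine ⟨har, ?_⟩
  obtain ⟨s, t, rfl⟩ := List.append_of_mem har
  have hperm : (s.reverse ++ v :: a :: t).Perm (v :: (s ++ a :: t)) := by
    refine List.perm_middle.trans ?_
    exact List.Perm.cons _ ((List.reverse_perm s).append_right _)
  have hc := h.1.2.1
  rw [← List.cons_append, List.isChain_append] at hc
  have hch : (s.reverse ++ v :: a :: t).IsChain G.Adj := by
    rw [List.isChain_split, List.isChain_cons_cons]
    refine ⟨?_, hva, hc.2.1⟩
    simpa using chain_reverse G hc.1
  have := hq s.reverse v a t (hperm.nodup_iff.2 h.1.1) hch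
  have h2 := h.2.1
  simp at this h2
  omega

/-- rotation -/
lemma rotate {G : SimpleGraph V} {A : Finset V} {k : ℕ} {c : List V}
    (h : MaxPath G A k c) (hcl : ∀ x ∈ c.getLast?, ∀ y ∈ c.head?, G.Adj x y)
    {x : V} (hx : x ∈ c) : ∃ r, MaxPath G A k (x :: r) ∧ ∀ y, y ∈ x :: r ↔ y ∈ c := by
  obtain ⟨s, t, rfl⟩ := List.append_of_mem hx
  have hperm : (x :: t ++ s).Perm (s ++ x :: t) := List.perm_append_comm
  refine ⟨t ++ s, h.of_perm hperm ?_, fun y => hperm.mem_iff⟩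
  have hc := List.isChain_append.1 h.1.2.1
  rw [← List.cons_append, List.isChain_append]
  refine ⟨hc.2.1, hc.1, fun a ha b hb => hcl a ?_ b ?_⟩
  · rw [List.getLast?_append]; simp at ha ⊢; simp [ha]
  · rw [List.head?_append]; simp at hb ⊢; simp [hb]

/-- Either some end has small degree, or there is a closed longest path. -/
lemma dichotomy {G : SimpleGraph V} [DecidableRel G.Adj] {A : Finset V} {k : ℕ} {l : List V}
    {p : Sym2 V → ℕ}
    (hq : ∀ s a b t, (s ++ a :: b :: t).Nodup → (s ++ a :: b :: t).IsChain G.Adj →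
      s.length + t.length + 1 ≤ p s(a, b))
    (h : MaxPath G A k l) :
    (∃ v r, MaxPath G A k (v :: r) ∧ 2 * (A.filter (G.Adj v)).card ≤ k) ∨
    (∃ c, MaxPath G A k c ∧ ∀ x ∈ c.getLast?, ∀ y ∈ c.head?, G.Adj x y) := by
  have hlen := h.2.1
  let N := (Finset.range k).filter (fun i => ∃ (hi : i + 1 < l.length), G.Adj l[0] l[i+1])
  let M := (Finset.range k).filter (fun i => ∃ (hi : i + 1 < l.length), G.Adj l[k] l[i])
  by_cases hd : Disjoint N M
  · left
    have hNM : N.card + M.card ≤ k := by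
      rw [← Finset.card_union_of_disjoint hd]
      calc _ ≤ (Finset.range k).card := Finset.card_le_card (by
            apply Finset.union_subset <;> apply Finset.filter_subset)
        _ = k := Finset.card_range k
    -- the head
    obtain ⟨v, r, rfl⟩ : ∃ v r, l = v :: r := by
      cases l with
      | nil => simp at hlen
      | cons v r => exact ⟨v, r, rfl⟩
    have hN : (A.filter (G.Adj v)).card ≤ N.card := by
      refine (Finset.card_le_card (t := N.image (fun i => (v :: r).getD (i+1) v)) ?_).trans
        Finset.card_image_le
      intro a ha
      rw [Finset.mem_filter] at ha
      obtain ⟨i, hi, rfl⟩ := List.getElem_of_mem (head_nbr hq h ha.1 ha.2).1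
      simp only [List.length_cons] at hlen
      refine Finset.mem_image.2 ⟨i, ?_, ?_⟩
      · simp only [N, Finset.mem_filter, Finset.mem_range]
        exact ⟨by omega, by simpa using hi, by simpa using ha.2⟩
      · simp [hi]
    have hrev : MaxPath G A k (v :: r).reverse :=
      h.of_perm (List.reverse_perm _) (chain_reverse G h.1.2.1)
    obtain ⟨u, q, hu⟩ : ∃ u q, (v :: r).reverse = u :: q := by
      cases hh : (v :: r).reverse with
      | nil => simp at hh
      | cons u q => exact ⟨u, q, rfl⟩
    rw [hu] at hrev
    have hu' : v :: r = q.reverse ++ [u] := by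
      rw [← List.reverse_reverse (v :: r), hu]; simp
    have hql : q.length = k := by simpa using hrev.2.1
    have hk : (v :: r)[k] = u := by
      simp only [hu']
      rw [List.getElem_append_right (by simp [hql])]
      simp
    have hM : (A.filter (G.Adj u)).card ≤ M.card := by
      refine (Finset.card_le_card (t := M.image (fun i => (v :: r).getD i v)) ?_).trans
        Finset.card_image_le
      intro a ha
      rw [Finset.mem_filter] at ha
      have haq := (head_nbr hq hrev ha.1 ha.2).1
      rw [← List.mem_reverse] at haq
      obtain ⟨i, hi, rfl⟩ := List.getElem_of_mem haq
      have hi' : i < k := by simpa [hql] using hi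
      have he : (v :: r)[i]'(by omega) = q.reverse[i] := by
        simp only [hu']
        rw [List.getElem_append_left]
      refine Finset.mem_image.2 ⟨i, ?_, ?_⟩
      · simp only [M, Finset.mem_filter, Finset.mem_range]
        refine ⟨hi', by omega, ?_⟩
        rw [hk, he]
        exact ha.2
      · rw [List.getD_eq_getElem _ _ (by omega), he]
    by_cases hle : 2 * (A.filter (G.Adj v)).card ≤ k
    · exact ⟨v, r, h, hle⟩
    · exact ⟨u, q, hrev, by omega⟩
  · right
    rw [Finset.not_disjoint_iff] at hd
    obtain ⟨i, hiN, hiM⟩ := hd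
    simp only [N, M, Finset.mem_filter, Finset.mem_range] at hiN hiM
    obtain ⟨hik, hi, h1⟩ := hiN
    obtain ⟨_, _, h2⟩ := hiM
    have hperm : (l.take (i+1) ++ (l.drop (i+1)).reverse).Perm l := by
      conv_rhs => rw [← List.take_append_drop (i+1) l]
      exact (List.reverse_perm _).append_left _
    have hc := h.1.2.1
    rw [← List.take_append_drop (i+1) l, List.isChain_append] at hc
    have hlast : l.getLast? = some l[k] := by
      rw [List.getLast?_eq_getElem?]; simp [hlen]
    refine ⟨_, h.of_perm hperm ?_, ?_⟩
    · rw [List.isChain_append]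
      refine ⟨hc.1, chain_reverse G hc.2.1, ?_⟩
      intro x hx y hy
      have hx' : x = l[i] := by
        rw [List.getLast?_eq_getElem?] at hx
        grind
      have hy' : y = l[k] := by
        rw [List.head?_reverse, List.getLast?_eq_getElem?] at hy
        grind
      rw [hx', hy']; exact h2.symm
    · intro x hx y hy
      have hx' : x = l[i+1] := by
        rw [List.getLast?_append, List.getLast?_reverse, List.head?_drop,
          List.getElem?_eq_getElem hi] at hx
        simpa using hx.symm
      have hy' : y = l[0] := by
        rw [List.head?_eq_getElem?] at hy
        grind
      rw [hx', hy']; exact h1.symm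

lemma main (G : SimpleGraph V) [DecidableRel G.Adj] (p : Sym2 V → ℕ)
    (hq : ∀ s a b t, (s ++ a :: b :: t).Nodup → (s ++ a :: b :: t).IsChain G.Adj →
      s.length + t.length + 1 ≤ p s(a, b)) (A : Finset V) :
    ∑ x ∈ A, ∑ y ∈ A, (if G.Adj x y then (1 : ℝ) / p s(x, y) else 0) ≤ A.card := by
  induction A using Finset.strongInduction with
  | H A ih =>
  rcases A.eq_empty_or_nonempty with rfl | hA
  · simp
  obtain ⟨k, l, hl⟩ := exists_maxPath G A hA
  set w : V → V → ℝ := fun x y => if G.Adj x y then (1 : ℝ) / p s(x, y) else 0 with hw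
  have hsymm : ∀ x y, w x y = w y x := by
    intro x y
    simp only [hw, G.adj_comm x y, Sym2.eq_swap (a := x)]
  have hdeg : ∀ v r, MaxPath G A k (v :: r) →
      ∑ y ∈ A, w v y ≤ (A.filter (G.Adj v)).card * (1 / (k : ℝ)) := by
    intro v r hv
    simp only [hw]
    rw [← Finset.sum_filter, ← nsmul_eq_mul]
    apply Finset.sum_le_card_nsmul
    intro y hy
    rw [Finset.mem_filter] at hy
    obtain ⟨hyr, hkp⟩ := head_nbr hq hv hy.1 hy.2
    have h2 : r.length = k := by simpa using hv.2.1
    have hk : 0 < k := h2 ▸ List.length_pos_of_mem hyr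
    apply one_div_le_one_div_of_le
    · exact_mod_cast hk
    · exact_mod_cast hkp
  have hkk : (k : ℝ) * (1 / (k : ℝ)) ≤ 1 := by
    rw [one_div]; exact mul_inv_le_one
  have hinv : (0 : ℝ) ≤ 1 / (k : ℝ) := by positivity
  rcases dichotomy hq hl with ⟨v, r, hv, hd⟩ | ⟨c, hc, hcl⟩
  · have hvA : v ∈ A := hv.1.2.2 v (by simp)
    have hih := ih (A.erase v) (Finset.erase_ssubset hvA)
    have hvv : w v v = 0 := by simp [hw]
    have hs := hdeg v r hv
    have hd' : 2 * ((A.filter (G.Adj v)).card : ℝ) ≤ k := by exact_mod_cast hd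
    have hsv : 2 * ∑ y ∈ A, w v y ≤ 1 := by
      nlinarith [mul_le_mul_of_nonneg_right hd' hinv]
    have hcard : ((A.erase v).card : ℝ) + 1 = A.card := by
      exact_mod_cast Finset.card_erase_add_one hvA
    have e1 : ∀ x, ∑ y ∈ A, w x y = ∑ y ∈ A.erase v, w x y + w x v := fun x =>
      (Finset.sum_erase_add A _ hvA).symm
    have e2 : ∑ x ∈ A.erase v, w x v = ∑ y ∈ A, w v y := by
      rw [e1 v, hvv, add_zero]
      exact Finset.sum_congr rfl (fun x _ => hsymm x v)
    have e3 : ∑ x ∈ A, ∑ y ∈ A, w x y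
        = ∑ x ∈ A.erase v, ∑ y ∈ A.erase v, w x y + 2 * ∑ y ∈ A, w v y := by
      rw [← Finset.sum_erase_add A _ hvA, Finset.sum_congr rfl (fun x _ => e1 x),
        Finset.sum_add_distrib, e2]
      ring
    rw [e3, ← hcard]
    exact add_le_add hih hsv
  · have hSA : c.toFinset ⊆ A := fun x hx => hc.1.2.2 x (List.mem_toFinset.1 hx)
    have hScard : c.toFinset.card = k + 1 := by
      rw [List.toFinset_card_of_nodup hc.1.1, hc.2.1]
    have hSne : c.toFinset.Nonempty := by
      rw [← Finset.card_pos]; omega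
    have hih := ih (A \ c.toFinset) (Finset.sdiff_ssubset hSA hSne)
    have hrow : ∀ x ∈ c.toFinset, ∑ y ∈ A, w x y ≤ 1 := by
      intro x hx
      obtain ⟨r, hr, hmem⟩ := rotate hc hcl (List.mem_toFinset.1 hx)
      refine (hdeg x r hr).trans (le_trans ?_ hkk)
      apply mul_le_mul_of_nonneg_right _ hinv
      have hsub : A.filter (G.Adj x) ⊆ r.toFinset := by
        intro y hy
        rw [Finset.mem_filter] at hy
        exact List.mem_toFinset.2 (head_nbr hq hr hy.1 hy.2).1
      have h2 : r.length = k := by simpa using hr.2.1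
      have := (Finset.card_le_card hsub).trans (List.toFinset_card_le r)
      rw [h2] at this
      exact_mod_cast this
    have hzero : ∀ x ∈ c.toFinset, ∀ y ∈ A \ c.toFinset, w x y = 0 := by
      intro x hx y hy
      rw [Finset.mem_sdiff] at hy
      obtain ⟨r, hr, hmem⟩ := rotate hc hcl (List.mem_toFinset.1 hx)
      simp only [hw]
      rw [if_neg]
      intro hadj
      apply hy.2
      rw [List.mem_toFinset, ← hmem]
      exact List.mem_cons_of_mem _ (head_nbr hq hr hy.1 hadj).1
    have e1 : ∀ x ∈ A \ c.toFinset, ∑ y ∈ A, w x y = ∑ y ∈ A \ c.toFinset, w x y := by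
      intro x hx
      rw [← Finset.sum_sdiff hSA]
      rw [Finset.sum_eq_zero (s := c.toFinset), add_zero]
      intro y hy
      rw [hsymm]; exact hzero y hy x hx
    have hcard : ((A \ c.toFinset).card : ℝ) + c.toFinset.card = A.card := by
      exact_mod_cast Finset.card_sdiff_add_card_eq_card hSA
    rw [← Finset.sum_sdiff hSA, Finset.sum_congr rfl e1, ← hcard]
    refine add_le_add hih ?_
    have := Finset.sum_le_card_nsmul _ _ _ hrow
    rw [nsmul_eq_mul, mul_one] at this
    exact this

lemma exists_walk (G : SimpleGraph V) (l : List V) : ∀ x, (x :: l).IsChain G.Adj →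
    ∃ (v : V) (w : G.Walk x v), w.support = x :: l ∧
      ∀ s a b t, x :: l = s ++ a :: b :: t → s(a, b) ∈ w.edges := by
  induction l with
  | nil =>
    intro x _
    refine ⟨x, SimpleGraph.Walk.nil, rfl, fun s a b t h => ?_⟩
    have := congrArg List.length h
    simp at this
    omega
  | cons y l ih =>
    intro x hc
    rw [List.isChain_cons_cons] at hc
    obtain ⟨v, w, hw, he⟩ := ih y hc.2
    refine ⟨v, SimpleGraph.Walk.cons hc.1 w, by simp [hw], fun s a b t h => ?_⟩
    rw [SimpleGraph.Walk.edges_cons]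
    cases s with
    | nil =>
      simp only [List.nil_append, List.cons.injEq] at h
      obtain ⟨rfl, rfl, rfl⟩ := h
      exact List.mem_cons_self
    | cons z s =>
      simp only [List.cons_append, List.cons.injEq] at h
      exact List.mem_cons_of_mem _ (he s a b t h.2)

end LocEG


/-- **Localized Erdős–Gallai theorem.** For any simple graph `G` on `n` vertices, where `p e` is
the largest `k` such that edge `e` lies on a path with `k` edges, we have
`∑_{e ∈ E(G)} 1/p(e) ≤ n/2`. -/
theorem localized_erdos_gallai {V : Type*} [Fintype V] [DecidableEq V]
    (G : SimpleGraph V) [DecidableRel G.Adj]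
    (p : Sym2 V → ℕ)
    (hp : ∀ e ∈ G.edgeFinset,
      IsGreatest {k : ℕ | ∃ (u v : V) (w : G.Walk u v),
        w.IsPath ∧ w.length = k ∧ e ∈ w.edges} (p e)) :
    ∑ e ∈ G.edgeFinset, (1 : ℝ) / (p e) ≤ (Fintype.card V : ℝ) / 2 := by
  classical
  have hq : ∀ s a b t, (s ++ a :: b :: t).Nodup → (s ++ a :: b :: t).IsChain G.Adj →
      s.length + t.length + 1 ≤ p s(a, b) := by
    intro s a b t hn hc
    have hab : G.Adj a b := (List.isChain_append_cons_cons.1 hc).2.1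
    refine (hp s(a, b) (by simpa using hab)).2 ?_
    cases hs : s ++ a :: b :: t with
    | nil => simp at hs
    | cons x l =>
      rw [hs] at hn hc
      obtain ⟨v, w, hw, he⟩ := LocEG.exists_walk G l x hc
      refine ⟨x, v, w, ?_, ?_, he s a b t hs.symm⟩
      · rw [SimpleGraph.Walk.isPath_def, hw]; exact hn
      · have h1 := w.length_support
        rw [hw, ← hs] at h1
        simp at h1
        omega
  have hmain := LocEG.main G p hq Finset.univ
  have hd : ∑ d : G.Dart, (1 : ℝ) / p d.edge = ∑ e ∈ G.edgeFinset, 2 * ((1 : ℝ) / p e) := by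
    rw [← Finset.sum_fiberwise_of_maps_to (s := Finset.univ) (t := G.edgeFinset)
      (g := fun d : G.Dart => d.edge) (fun d _ => by simpa using d.edge_mem)]
    refine Finset.sum_congr rfl fun e he => ?_
    rw [Finset.sum_congr rfl (g := fun _ => (1 : ℝ) / p e)
      (fun d hd => by rw [(Finset.mem_filter.1 hd).2]), Finset.sum_const,
      G.dart_edge_fiber_card e (by simpa using he)]
    simp
  have hd2 : ∑ d : G.Dart, (1 : ℝ) / p d.edge
      = ∑ x, ∑ y, (if G.Adj x y then (1 : ℝ) / p s(x, y) else 0) := by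
    rw [← Finset.sum_product', Finset.univ_product_univ, ← Finset.sum_filter]
    refine Finset.sum_bij (fun d _ => d.toProd) ?_ ?_ ?_ ?_
    · intro d _; simpa using d.adj
    · intro d _ d' _ h; exact SimpleGraph.Dart.ext _ _ h
    · intro q hq'; exact ⟨⟨q, by simpa using hq'⟩, by simp, rfl⟩
    · intro d _; rfl
  rw [← hd2, hd, ← Finset.mul_sum, Finset.card_univ] at hmain
  linarith
end

section
/- Let G be a perfect graph on n vertices. For each vertex v, let c(v) be the largest size of a clique of G containing v and let i(v) be the largest size of an independent set of G containing v. Then the sum over all vertices v of 1/(c(v)·i(v)) is at most 1. -/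
/-- A simple graph is perfect if for every induced subgraph, the chromatic number equals the
clique number. -/
def SimpleGraph.IsPerfect {V : Type*} (G : SimpleGraph V) : Prop :=
  ∀ S : Set V, (G.induce S).chromaticNumber = ((G.induce S).cliqueNum : ℕ∞)

open Classical in
theorem weighted_cover {V : Type*} [Fintype V] (G : SimpleGraph V) (hG : G.IsPerfect) :
    ∀ (m : ℕ) (w : V → ℕ) (N : ℕ), ∑ v, w v = m →
      (∀ K : Finset V, G.IsClique (K : Set V) → ∑ v ∈ K, w v ≤ N) →
      ∃ f : Fin N → Finset V,
        (∀ j, ((f j : Finset V) : Set V).Pairwise fun a b => ¬ G.Adj a b) ∧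
        ∀ v, w v ≤ ∑ j, if v ∈ f j then 1 else 0 := by
  intro m
  induction m using Nat.strong_induction_on with
  | _ m ih =>
  intro w N hm hK
  by_cases hbig : ∃ v, 2 ≤ w v
  · obtain ⟨v, hv⟩ := hbig
    have hN : 2 ≤ N := by
      have := hK {v} (by simp)
      simp at this
      omega
    obtain ⟨M, rfl⟩ : ∃ M, N = M + 1 := ⟨N - 1, by omega⟩
    let w' : V → ℕ := fun u => if u = v then w u - 1 else w u
    have hw'le : ∀ u, w' u ≤ w u := by
      intro u; simp only [w']; split_ifs <;> omega
    have hw'v : w' v = w v - 1 := by simp [w']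
    have hlt : ∑ u, w' u < m := by
      rw [← hm]
      exact Finset.sum_lt_sum (fun u _ => hw'le u) ⟨v, Finset.mem_univ _, by omega⟩
    obtain ⟨f, hf, hcov⟩ := ih _ hlt w' (M + 1) rfl
      (fun K h => (Finset.sum_le_sum (fun u _ => hw'le u)).trans (hK K h))
    obtain ⟨j, hj⟩ : ∃ j, v ∈ f j := by
      by_contra hno
      push Not at hno
      have := hcov v
      simp [hno] at this
      omega
    let w2 : V → ℕ := fun u => if u ∈ f j then w u - 1 else w u
    have hw2le : ∀ u, w2 u ≤ w u := by
      intro u; simp only [w2]; split_ifs <;> omega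
    have hw2v : w2 v = w v - 1 := by simp [w2, hj]
    have hlt2 : ∑ u, w2 u < m := by
      rw [← hm]
      exact Finset.sum_lt_sum (fun u _ => hw2le u) ⟨v, Finset.mem_univ _, by omega⟩
    have hK2 : ∀ K : Finset V, G.IsClique (K : Set V) → ∑ u ∈ K, w2 u ≤ M := by
      intro K hKc
      by_contra hcon
      push Not at hcon
      have h1 := hK K hKc
      have h2 : ∑ u ∈ K, w2 u ≤ ∑ u ∈ K, w u := Finset.sum_le_sum (fun u _ => hw2le u)
      have heq : ∑ u ∈ K, w2 u = ∑ u ∈ K, w u := by omega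
      have hpt := (Finset.sum_eq_sum_iff_of_le (fun u _ => hw2le u)).1 heq
      have hz : ∀ u ∈ K, u ∈ f j → w u = 0 := by
        intro u hu huj
        have := hpt u hu
        simp [w2, huj] at this
        omega
      have hvK : v ∉ K := fun h => by
        have := hz v h hj
        omega
      have hw'K : ∑ u ∈ K, w' u = M + 1 := by
        have : ∑ u ∈ K, w' u = ∑ u ∈ K, w u := by
          apply Finset.sum_congr rfl
          intro u hu
          have : u ≠ v := fun h => hvK (h ▸ hu)
          simp [w', this]
        omega
      let K0 := K.filter (fun u => w' u ≠ 0)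
      have hK0 : ∑ u ∈ K0, w' u = M + 1 := by
        rw [← hw'K]; exact Finset.sum_filter_ne_zero K
      have hle : M + 1 ≤ ∑ l : Fin (M+1), (K0 ∩ f l).card := by
        refine hK0.symm.le.trans ?_
        calc ∑ u ∈ K0, w' u ≤ ∑ u ∈ K0, ∑ l, (if u ∈ f l then 1 else 0) :=
              Finset.sum_le_sum (fun u _ => hcov u)
          _ = ∑ l : Fin (M+1), (K0 ∩ f l).card := by
              rw [Finset.sum_comm]
              apply Finset.sum_congr rfl
              intro l _
              simp
      have hone : ∀ l, (K0 ∩ f l).card ≤ 1 := by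
        intro l
        rw [Finset.card_le_one]
        intro a ha b hb
        simp only [Finset.mem_inter, K0, Finset.mem_filter] at ha hb
        by_contra hab
        exact hf l ha.2 hb.2 hab (hKc ha.1.1 hb.1.1 hab)
      have hj0 : (K0 ∩ f j).card = 0 := by
        rw [Finset.card_eq_zero, Finset.eq_empty_iff_forall_notMem]
        intro u hu
        simp only [Finset.mem_inter, K0, Finset.mem_filter] at hu
        have := hz u hu.1.1 hu.2
        have := hw'le u
        omega
      have : ∑ l : Fin (M+1), (K0 ∩ f l).card < ∑ l : Fin (M+1), 1 :=
        Finset.sum_lt_sum (fun l _ => hone l) ⟨j, Finset.mem_univ _, by omega⟩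
      simp at this
      omega
    obtain ⟨g, hg, hgc⟩ := ih _ hlt2 w2 M rfl hK2
    refine ⟨Fin.cons (f j) g, ?_, ?_⟩
    · intro l
      refine Fin.cases ?_ (fun l => ?_) l
      · simpa using hf j
      · simpa using hg l
    · intro u
      rw [Fin.sum_univ_succ]
      simp only [Fin.cons_zero, Fin.cons_succ]
      have := hgc u
      simp only [w2] at this
      split_ifs at this ⊢ <;> omega
  · push Not at hbig
    let S : Set V := {v | w v = 1}
    have hcl : (G.induce S).cliqueNum ≤ N := by
      obtain ⟨s, hs⟩ := (G.induce S).exists_isNClique_cliqueNum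
      have h := hK (s.map (Function.Embedding.subtype _)) (by
        intro a ha b hb hab
        simp only [Finset.coe_map, Set.mem_image] at ha hb
        obtain ⟨a, ha, rfl⟩ := ha
        obtain ⟨b, hb, rfl⟩ := hb
        exact hs.isClique ha hb (fun h => hab (by rw [h])))
      rw [Finset.sum_map] at h
      have h2 : ∑ x ∈ s, w ((Function.Embedding.subtype _) x) = ∑ x ∈ s, 1 :=
        Finset.sum_congr rfl (fun x _ => x.2)
      rw [h2] at h
      simp only [Finset.sum_const, smul_eq_mul, mul_one] at h
      rw [← hs.card_eq]
      exact h
    have hcol : (G.induce S).Colorable N := by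
      rw [← SimpleGraph.chromaticNumber_le_iff_colorable, hG S]
      exact_mod_cast hcl
    obtain ⟨C⟩ := hcol
    refine ⟨fun j => Finset.univ.filter (fun v => ∃ h : v ∈ S, C ⟨v, h⟩ = j), ?_, ?_⟩
    · intro j a ha b hb hab hadj
      simp only [Finset.coe_filter, Finset.mem_univ, true_and, Set.mem_ofPred_eq] at ha hb
      obtain ⟨ha, hca⟩ := ha
      obtain ⟨hb, hcb⟩ := hb
      exact C.valid (v := ⟨a, ha⟩) (w := ⟨b, hb⟩) hadj (hca.trans hcb.symm)
    · intro v
      by_cases hv : w v = 1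
      · rw [hv]
        refine le_trans ?_ (Finset.single_le_sum (fun _ _ => Nat.zero_le _)
          (Finset.mem_univ (C ⟨v, hv⟩)))
        rw [if_pos]
        simp only [Finset.mem_filter, Finset.mem_univ, true_and]
        exact ⟨hv, by trivial⟩
      · have := hbig v
        have : w v = 0 := by omega
        omega

/-- **Localized perfect graph theorem.** For a perfect graph `G` on `n` vertices, where `c v` is
the largest size of a clique containing `v` and `i v` the largest size of an independent set
containing `v`, we have `∑_v 1/(c(v)·i(v)) ≤ 1`. -/
theorem localized_perfect {V : Type*} [Fintype V] [DecidableEq V]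
    (G : SimpleGraph V) (hG : G.IsPerfect)
    (c i : V → ℕ)
    (hc : ∀ v : V, IsGreatest {k : ℕ | ∃ t : Finset V, G.IsNClique k t ∧ v ∈ t} (c v))
    (hi : ∀ v : V, IsGreatest {k : ℕ | ∃ t : Finset V,
      ((t : Set V).Pairwise fun a b => ¬ G.Adj a b) ∧ t.card = k ∧ v ∈ t} (i v)) :
    ∑ v : V, (1 : ℝ) / ((c v : ℝ) * (i v : ℝ)) ≤ 1 := by
  classical
  have hcpos : ∀ v, 0 < c v := fun v => by
    have : 1 ≤ c v := (hc v).2 ⟨{v}, by simp [SimpleGraph.isNClique_iff], by simp⟩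
    omega
  have hipos : ∀ v, 0 < i v := fun v => by
    have : 1 ≤ i v := (hi v).2 ⟨{v}, by simp, by simp, by simp⟩
    omega
  set N := ∏ v, c v with hN
  have hNpos : 0 < N := Finset.prod_pos (fun v _ => hcpos v)
  have hdvd : ∀ v, c v ∣ N := fun v => Finset.dvd_prod_of_mem c (Finset.mem_univ v)
  obtain ⟨f, hf, hcov⟩ := weighted_cover G hG _ (fun v => N / c v) N rfl (by
    intro K hK
    calc ∑ v ∈ K, N / c v ≤ ∑ v ∈ K, N / K.card := by
          apply Finset.sum_le_sum
          intro v hv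
          exact Nat.div_le_div_left ((hc v).2 ⟨K, ⟨hK, rfl⟩, hv⟩) (Finset.card_pos.2 ⟨v, hv⟩)
      _ ≤ N := by
          simp only [Finset.sum_const, smul_eq_mul]
          exact Nat.mul_div_le N K.card)
  have hNR : (0 : ℝ) < N := by exact_mod_cast hNpos
  have key : (N : ℝ) * ∑ v : V, (1 : ℝ) / ((c v : ℝ) * (i v : ℝ)) ≤ N * 1 := by
    calc (N : ℝ) * ∑ v : V, (1 : ℝ) / ((c v : ℝ) * (i v : ℝ))
        = ∑ v : V, ((N / c v : ℕ) : ℝ) * (1 / (i v : ℝ)) := by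
          rw [Finset.mul_sum]
          apply Finset.sum_congr rfl
          intro v _
          have h1 : (c v : ℝ) ≠ 0 := by exact_mod_cast (hcpos v).ne'
          have h2 : (i v : ℝ) ≠ 0 := by exact_mod_cast (hipos v).ne'
          rw [Nat.cast_div (hdvd v) h1]
          field_simp
      _ ≤ ∑ v : V, (∑ j : Fin N, if v ∈ f j then (1 : ℝ) else 0) * (1 / (i v : ℝ)) := by
          apply Finset.sum_le_sum
          intro v _
          apply mul_le_mul_of_nonneg_right _ (by positivity)
          have := hcov v
          have h3 : ((N / c v : ℕ) : ℝ) ≤ ((∑ j : Fin N, if v ∈ f j then 1 else 0 : ℕ) : ℝ) := by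
            refine Nat.cast_le.2 (this.trans (le_of_eq ?_))
            congr!
          refine h3.trans (le_of_eq ?_)
          push_cast
          rfl
      _ = ∑ j : Fin N, ∑ v ∈ f j, (1 / (i v : ℝ)) := by
          simp only [Finset.sum_mul]
          rw [Finset.sum_comm]
          apply Finset.sum_congr rfl
          intro j _
          simp [ite_mul, Finset.sum_ite_mem]
      _ ≤ ∑ j : Fin N, (1 : ℝ) := by
          apply Finset.sum_le_sum
          intro j _
          calc ∑ v ∈ f j, (1 / (i v : ℝ)) ≤ ∑ v ∈ f j, (1 / ((f j).card : ℝ)) := by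
                apply Finset.sum_le_sum
                intro v hv
                apply one_div_le_one_div_of_le
                · exact_mod_cast Finset.card_pos.2 ⟨v, hv⟩
                · exact_mod_cast (hi v).2 ⟨f j, hf j, rfl, hv⟩
            _ ≤ 1 := by
                simp only [Finset.sum_const, nsmul_eq_mul, one_div]
                exact mul_inv_le_one
      _ = N * 1 := by simp
  exact le_of_mul_le_mul_left key hNR
end
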